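/- The value ξ₀* := inf{ r ∈ ℝ : every ξ₀ > r is of type 1 } is not of type 3; that is, for the solution with initial condition (ξ₀*, θ*, π/2) there exists some t > 0 with either ξ'_{ξ₀*}(t) = 0 or θ_{ξ₀*}(t) = θ*. -/

import Mathlib

/-- The constant `m = m₁ + m₂ + 2/g`. -/
noncomputable def mconst (g m₁ m₂ : ℕ) : ℝ := (m₁ : ℝ) + (m₂ : ℝ) + 2 / (g : ℝ)

/-- The angle `θ* = arctan √(m₁/m₂)`. -/
noncomputable def thetaStar (m₁ m₂ : ℕ) : ℝ :=
  Real.arctan (Real.sqrt ((m₁ : ℝ) / (m₂ : ℝ)))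

/-- `l(θ) = m₁ cos² θ - m₂ sin² θ`. -/
noncomputable def lfun (m₁ m₂ : ℕ) (θ : ℝ) : ℝ :=
  (m₁ : ℝ) * Real.cos θ ^ 2 - (m₂ : ℝ) * Real.sin θ ^ 2

/-- `(ξ, θ, α)` is a (globally defined) solution of the ODE system (*):
`ξ' = cos α · sin 2θ`, `θ' = sin α · sin 2θ`,
`α' = sin α · sin 2θ · (exp((4/g)ξ) - m) + 2 cos α · l(θ)`. -/
def IsSolution (g m₁ m₂ : ℕ) (ξ θ α : ℝ → ℝ) : Prop :=
  ∀ t : ℝ,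
    HasDerivAt ξ (Real.cos (α t) * Real.sin (2 * θ t)) t ∧
    HasDerivAt θ (Real.sin (α t) * Real.sin (2 * θ t)) t ∧
    HasDerivAt α
      (Real.sin (α t) * Real.sin (2 * θ t) *
          (Real.exp (4 / (g : ℝ) * ξ t) - mconst g m₁ m₂) +
        2 * Real.cos (α t) * lfun m₁ m₂ (θ t)) t

/-- `Ξ Θ A` is the family of solutions of (*) indexed by the initial value `ξ₀`,
with initial condition `(ξ, θ, α)(0) = (ξ₀, θ*, π/2)`. -/
def IsShootingFamily (g m₁ m₂ : ℕ) (Ξ Θ A : ℝ → ℝ → ℝ) : Prop :=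
  ∀ ξ₀ : ℝ, IsSolution g m₁ m₂ (Ξ ξ₀) (Θ ξ₀) (A ξ₀) ∧
    Ξ ξ₀ 0 = ξ₀ ∧ Θ ξ₀ 0 = thetaStar m₁ m₂ ∧ A ξ₀ 0 = Real.pi / 2

/-- `ξ₀` is of type 1: there is `T > 0` with `θ_{ξ₀}(T) = θ*` and
`ξ'_{ξ₀}(t) ≠ 0` for all `t ∈ (0, T)`. -/
def Type1 (m₁ m₂ : ℕ) (Ξ Θ A : ℝ → ℝ → ℝ) (ξ₀ : ℝ) : Prop :=
  ∃ T > (0 : ℝ), Θ ξ₀ T = thetaStar m₁ m₂ ∧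
    ∀ t ∈ Set.Ioo (0 : ℝ) T, Real.cos (A ξ₀ t) * Real.sin (2 * Θ ξ₀ t) ≠ 0

/-- `ξ₀* = inf { r : every ξ₀ > r is of type 1 }`. -/
noncomputable def xiStar (m₁ m₂ : ℕ) (Ξ Θ A : ℝ → ℝ → ℝ) : ℝ :=
  sInf {r : ℝ | ∀ ξ₀ > r, Type1 m₁ m₂ Ξ Θ A ξ₀}

theorem le_of_hasDerivAt_ge {f f' : ℝ → ℝ} {a b c : ℝ} (hab : a ≤ b)
    (hf : ∀ t, HasDerivAt f (f' t) t) (hc : ∀ t ∈ Set.Ioo a b, c ≤ f' t) :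
    f a + c * (b - a) ≤ f b := by
  have := (convex_Icc a b).mul_sub_le_image_sub_of_le_deriv (f := f) (C := c)
    (fun t _ => (hf t).continuousAt.continuousWithinAt)
    (fun t _ => (hf t).differentiableAt.differentiableWithinAt)
    (fun t ht => by rw [(hf t).deriv]; exact hc t (by simpa using ht))
    a (Set.left_mem_Icc.2 hab) b (Set.right_mem_Icc.2 hab) hab
  linarith

theorem le_of_hasDerivAt_nonneg {f f' : ℝ → ℝ} {a b : ℝ} (hab : a ≤ b)
    (hf : ∀ t, HasDerivAt f (f' t) t) (hc : ∀ t ∈ Set.Ioo a b, 0 ≤ f' t) : f a ≤ f b := by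
  simpa using le_of_hasDerivAt_ge hab hf hc

theorem lt_on_Ioo_of_ne {f : ℝ → ℝ} {a b p : ℝ} (hf : ContinuousOn f (Set.Ico a b))
    (ha : f a < p) (hne : ∀ t ∈ Set.Ioo a b, f t ≠ p) : ∀ t ∈ Set.Ioo a b, f t < p := by
  intro t ht
  by_contra! hlt
  obtain ⟨s, hs, hsp⟩ := intermediate_value_Icc ht.1.le
    (hf.mono fun x hx => ⟨hx.1, hx.2.trans_lt ht.2⟩) ⟨ha.le, hlt⟩
  refine hne s ⟨lt_of_le_of_ne hs.1 ?_, hs.2.trans_lt ht.2⟩ hsp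
  rintro rfl
  exact ha.ne hsp

/-- A function that leaves the value `p` upwards and never takes it again stays above it. -/
theorem gt_on_Ioo_of_deriv_pos {f f' : ℝ → ℝ} {a b : ℝ}
    (hf : ∀ t, HasDerivAt f (f' t) t) (ha : 0 < f' a)
    (hne : ∀ t ∈ Set.Ioo a b, f t ≠ f a) : ∀ t ∈ Set.Ioo a b, f a < f t := by
  intro t ht
  have hcont : Continuous f := continuous_iff_continuousAt.2 fun t => (hf t).continuousAt
  have hslope := ((hasDerivAt_iff_tendsto_slope.1 (hf a)).mono_left
    (nhdsWithin_mono a (fun x (hx : x ∈ Set.Ioi a) => ne_of_gt hx))).eventually (lt_mem_nhds ha)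
  obtain ⟨s, hs, hsa⟩ := (hslope.and (Ioo_mem_nhdsGT ht.1)).exists
  have hfs : f a < f s := by
    rw [slope_def_field, lt_div_iff₀ (sub_pos.2 hsa.1)] at hs
    linarith
  by_contra! hlt
  obtain ⟨r, hr, hrp⟩ := intermediate_value_Icc' hsa.2.le hcont.continuousOn ⟨hlt, hfs.le⟩
  exact hne r ⟨hsa.1.trans_le hr.1, hr.2.trans_lt ht.2⟩ hrp

/-- A level that is crossed upwards only is a lower barrier. -/
theorem ge_on_Icc_of_deriv_pos {f f' : ℝ → ℝ} {a b p : ℝ}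
    (hf : ∀ t, HasDerivAt f (f' t) t) (ha : p ≤ f a)
    (hpos : ∀ t ∈ Set.Ico a b, f t = p → 0 < f' t) : ∀ t ∈ Set.Icc a b, p ≤ f t := by
  have := image_le_of_deriv_right_lt_deriv_boundary' (f := fun _ => p) (f' := fun _ => 0)
    (a := a) (b := b) continuousOn_const (fun x _ => hasDerivWithinAt_const x _ _) (B := f)
    (B' := f') ha (fun t _ => (hf t).continuousAt.continuousWithinAt)
    (fun t _ => (hf t).hasDerivWithinAt) (fun t ht h => hpos t ht h.symm)
  exact fun t ht => this ht

/-- The first time at which a continuous function comes down to the level `p`. -/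
theorem exists_first_hit {f : ℝ → ℝ} {a b p : ℝ} (hab : a ≤ b) (hf : Continuous f)
    (ha : p < f a) (hb : f b ≤ p) :
    ∃ c, a < c ∧ c ≤ b ∧ f c = p ∧ ∀ t ∈ Set.Ico a c, p < f t := by
  have hcl : IsCompact (Set.Icc a b ∩ f ⁻¹' Set.Iic p) :=
    isCompact_Icc.inter_right (isClosed_Iic.preimage hf)
  obtain ⟨c, ⟨hcab, hcp⟩, hmin⟩ := hcl.exists_isLeast ⟨b, ⟨hab, le_rfl⟩, hb⟩
  have hlt : ∀ t ∈ Set.Ico a c, p < f t := fun t ht => by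
    by_contra! h
    exact absurd (hmin ⟨⟨ht.1, ht.2.le.trans hcab.2⟩, h⟩) (not_le.2 ht.2)
  have hac : a < c := lt_of_le_of_ne hcab.1 (by rintro rfl; exact absurd hcp (not_le.2 ha))
  refine ⟨c, hac, hcab.2, le_antisymm hcp ?_, hlt⟩
  obtain ⟨s, hs, hsp⟩ := intermediate_value_Icc' hcab.1 hf.continuousOn ⟨hcp, ha.le⟩
  rcases hs.2.eq_or_lt with rfl | h
  · exact hsp.ge
  · exact absurd hsp (hlt s ⟨hs.1, h⟩).ne'

theorem thetaStar_pos {m₁ m₂ : ℕ} (hm₁ : 0 < m₁) (hm₂ : 0 < m₂) : 0 < thetaStar m₁ m₂ := by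
  have : (0 : ℝ) < m₁ / m₂ := by positivity
  exact Real.arctan_pos.2 (Real.sqrt_pos.2 this)

theorem thetaStar_lt (m₁ m₂ : ℕ) : thetaStar m₁ m₂ < Real.pi / 2 := Real.arctan_lt_pi_div_two _

theorem lfun_eq (m₁ m₂ : ℕ) (x : ℝ) :
    lfun m₁ m₂ x = (m₁ : ℝ) - (m₁ + m₂) * Real.sin x ^ 2 := by
  have := Real.sin_sq_add_cos_sq x
  rw [lfun, show Real.cos x ^ 2 = 1 - Real.sin x ^ 2 by linarith]
  ring

theorem lfun_thetaStar {m₁ m₂ : ℕ} (hm₂ : 0 < m₂) : lfun m₁ m₂ (thetaStar m₁ m₂) = 0 := by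
  have h2 : (0 : ℝ) < m₂ := by exact_mod_cast hm₂
  have h1 : (0 : ℝ) ≤ (m₁ : ℝ) / m₂ := by positivity
  rw [lfun, thetaStar, Real.cos_sq_arctan, Real.sin_sq, Real.cos_sq_arctan, Real.sq_sqrt h1]
  field_simp
  ring

theorem lfun_lt {m₁ m₂ : ℕ} (hm₁ : 0 < m₁) {x y : ℝ} (hx : 0 ≤ x) (hxy : x < y)
    (hy : y ≤ Real.pi / 2) : lfun m₁ m₂ y < lfun m₁ m₂ x := by
  have h1 : (0 : ℝ) < m₁ := by exact_mod_cast hm₁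
  have hs := Real.sin_lt_sin_of_lt_of_le_pi_div_two (by linarith [Real.pi_pos]) hy hxy
  have h0 := Real.sin_nonneg_of_nonneg_of_le_pi hx (by linarith [Real.pi_pos])
  have : Real.sin x ^ 2 < Real.sin y ^ 2 := by gcongr
  have h3 : (0 : ℝ) < m₁ + m₂ := by positivity
  rw [lfun_eq, lfun_eq]
  nlinarith

theorem lfun_neg {m₁ m₂ : ℕ} (hm₁ : 0 < m₁) (hm₂ : 0 < m₂) {x : ℝ} (hx : thetaStar m₁ m₂ < x)
    (hx' : x ≤ Real.pi / 2) : lfun m₁ m₂ x < 0 :=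
  (lfun_lt hm₁ (thetaStar_pos hm₁ hm₂).le hx hx').trans_eq (lfun_thetaStar hm₂)

theorem abs_lfun_le (m₁ m₂ : ℕ) (x : ℝ) : |lfun m₁ m₂ x| ≤ m₁ + m₂ := by
  have h1 : (0 : ℝ) ≤ m₁ := by positivity
  have h2 : (0 : ℝ) ≤ m₂ := by positivity
  have := Real.sin_sq_add_cos_sq x
  rw [lfun, abs_le]
  constructor <;> nlinarith [sq_nonneg (Real.sin x), sq_nonneg (Real.cos x)]

theorem exists_sin_two_mul_ge {a b : ℝ} (ha : 0 < a) (hb : b < Real.pi / 2) :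
    ∃ σ > 0, ∀ x ∈ Set.Icc a b, σ ≤ Real.sin (2 * x) := by
  rcases le_or_gt a b with hab | hab
  · obtain ⟨c, hc, hmin⟩ := isCompact_Icc.exists_isMinOn (Set.nonempty_Icc.2 hab)
      (f := fun x => Real.sin (2 * x)) (by fun_prop)
    exact ⟨_, Real.sin_pos_of_pos_of_lt_pi (by linarith [hc.1]) (by linarith [hc.2]),
      fun x hx => hmin hx⟩
  · exact ⟨1, one_pos, fun x hx => absurd (hx.1.trans hx.2) (not_le.2 hab)⟩

namespace IsSolution

variable {g m₁ m₂ : ℕ} {ξ θ α : ℝ → ℝ}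

theorem continuous_theta (h : IsSolution g m₁ m₂ ξ θ α) : Continuous θ :=
  continuous_iff_continuousAt.2 fun t => (h t).2.1.continuousAt

theorem continuous_alpha (h : IsSolution g m₁ m₂ ξ θ α) : Continuous α :=
  continuous_iff_continuousAt.2 fun t => (h t).2.2.continuousAt

theorem theta_mem_Ioo (h : IsSolution g m₁ m₂ ξ θ α) (h0 : θ 0 ∈ Set.Ioo 0 (Real.pi / 2)) :
    ∀ t ≥ 0, θ t ∈ Set.Ioo 0 (Real.pi / 2) := by
  have hS : ∀ t, HasDerivAt (fun t => Real.sin (2 * θ t) ^ 2 * Real.exp (4 * t))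
      (Real.sin (2 * θ t) ^ 2 * Real.exp (4 * t) *
        (4 + 4 * Real.cos (2 * θ t) * Real.sin (α t))) t := fun t => by
    have h1 := (((h t).2.1.const_mul 2).sin.pow 2).mul
      (((hasDerivAt_id t).const_mul 4).exp)
    refine h1.congr_deriv ?_
    simp
    ring
  have hne : ∀ t ≥ 0, Real.sin (2 * θ t) ≠ 0 := fun t ht hz => by
    have h1 := le_of_hasDerivAt_nonneg (a := 0) (b := t) ht hS fun s _ => by
      have h2 : -1 ≤ Real.cos (2 * θ s) * Real.sin (α s) := by
        have := abs_mul (Real.cos (2 * θ s)) (Real.sin (α s))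
        have h3 := mul_le_one₀ (Real.abs_cos_le_one (2 * θ s)) (abs_nonneg _)
          (Real.abs_sin_le_one (α s))
        exact neg_le_of_abs_le (this.trans_le h3)
      exact mul_nonneg (by positivity) (by linarith)
    have h2 : 0 < Real.sin (2 * θ 0) :=
      Real.sin_pos_of_pos_of_lt_pi (by linarith [h0.1]) (by linarith [h0.2])
    simp only [hz, mul_zero, Real.exp_zero, mul_one] at h1
    nlinarith
  intro t ht
  constructor
  · by_contra! hlt
    obtain ⟨s, hs, hsp⟩ := intermediate_value_Icc' ht h.continuous_theta.continuousOn
      ⟨hlt, h0.1.le⟩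
    exact hne s hs.1 (by simp [hsp])
  · by_contra! hlt
    obtain ⟨s, hs, hsp⟩ := intermediate_value_Icc ht h.continuous_theta.continuousOn
      ⟨h0.2.le, hlt⟩
    exact hne s hs.1 (by rw [hsp, show 2 * (Real.pi / 2) = Real.pi by ring, Real.sin_pi])

theorem sin_two_theta_pos (h : IsSolution g m₁ m₂ ξ θ α)
    (h0 : θ 0 ∈ Set.Ioo 0 (Real.pi / 2)) {t : ℝ} (ht : 0 ≤ t) : 0 < Real.sin (2 * θ t) := by
  have := h.theta_mem_Ioo h0 t ht
  exact Real.sin_pos_of_pos_of_lt_pi (by linarith [this.1]) (by linarith [this.2])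

theorem continuous_xi (h : IsSolution g m₁ m₂ ξ θ α) : Continuous ξ :=
  continuous_iff_continuousAt.2 fun t => (h t).1.continuousAt

/-- The cylinder: if `ξ` starts at the value where `exp (4 / g * ξ) = m` and `cos α` starts at
zero, then `cos α` stays zero. -/
theorem cos_alpha_eq_zero (h : IsSolution g m₁ m₂ ξ θ α)
    (hξ : Real.exp (4 / (g : ℝ) * ξ 0) = mconst g m₁ m₂) (hα : Real.cos (α 0) = 0)
    {T : ℝ} (hT : 0 ≤ T) : Real.cos (α T) = 0 := by
  have hcξ := h.continuous_xi
  have hcθ := h.continuous_theta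
  have hcα := h.continuous_alpha
  set p : ℝ → ℝ := fun t => Real.exp (4 / (g : ℝ) * ξ t) - mconst g m₁ m₂ with hp
  set q : ℝ → ℝ := fun t => Real.cos (α t) with hq
  set a : ℝ → ℝ := fun t => 4 / (g : ℝ) * Real.exp (4 / (g : ℝ) * ξ t) * Real.sin (2 * θ t) -
    Real.sin (α t) ^ 2 * Real.sin (2 * θ t) with ha
  set b : ℝ → ℝ := fun t => -2 * Real.sin (α t) * lfun m₁ m₂ (θ t) with hb
  have hN : ∀ t, HasDerivAt (fun t => p t ^ 2 + q t ^ 2)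
      (2 * (p t * q t) * a t + 2 * q t ^ 2 * b t) t := fun t => by
    refine (((((h t).1.const_mul (4 / (g : ℝ))).exp.sub_const (mconst g m₁ m₂)).pow 2).add
      ((h t).2.2.cos.pow 2)).congr_deriv ?_
    simp only [hp, hq, ha, hb]
    push_cast
    ring
  have hca : Continuous a := by fun_prop
  have hcb : Continuous b := by unfold b lfun; fun_prop
  obtain ⟨A, hA⟩ := isCompact_Icc.exists_bound_of_continuousOn (s := Set.Icc 0 T) hca.continuousOn
  obtain ⟨B, hB⟩ := isCompact_Icc.exists_bound_of_continuousOn (s := Set.Icc 0 T) hcb.continuousOn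
  have hG : ∀ t, HasDerivAt (fun t => -((p t ^ 2 + q t ^ 2) * Real.exp (-(A + 2 * B) * t)))
      (((A + 2 * B) * (p t ^ 2 + q t ^ 2) - (2 * (p t * q t) * a t + 2 * q t ^ 2 * b t)) *
        Real.exp (-(A + 2 * B) * t)) t := fun t => by
    refine ((hN t).mul (((hasDerivAt_id t).const_mul (-(A + 2 * B))).exp)).neg.congr_deriv ?_
    simp
    ring
  have key := le_of_hasDerivAt_nonneg hT hG fun t ht => by
    refine mul_nonneg ?_ (Real.exp_nonneg _)
    have ht' : t ∈ Set.Icc 0 T := ⟨ht.1.le, ht.2.le⟩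
    have h1 := abs_le.1 (hA t ht')
    have h2 := abs_le.1 (hB t ht')
    nlinarith [mul_nonneg (sq_nonneg (p t - q t)) (by linarith : 0 ≤ A + a t),
      mul_nonneg (sq_nonneg (p t + q t)) (by linarith : 0 ≤ A - a t),
      mul_nonneg (sq_nonneg (q t)) (by linarith : 0 ≤ B - b t),
      mul_nonneg (sq_nonneg (p t)) (by linarith : 0 ≤ B)]
  have hp0 : p 0 = 0 := by simp [hp, hξ]
  have hq0 : q 0 = 0 := hα
  simp only [hp0, hq0] at key
  have hE := Real.exp_pos (-(A + 2 * B) * T)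
  have : p T ^ 2 + q T ^ 2 ≤ 0 := by
    by_contra! hlt
    have := mul_pos hlt hE
    simp only [ne_eq, OfNat.ofNat_ne_zero, not_false_eq_true, zero_pow, add_zero, zero_mul,
      neg_zero] at key
    linarith
  have hqT : q T ^ 2 = 0 := by nlinarith [sq_nonneg (p T), sq_nonneg (q T)]
  exact pow_eq_zero_iff two_ne_zero |>.1 hqT

/-- The right-hand side of the system as a vector field on `ℝ × ℝ × ℝ`. -/
noncomputable def field (g m₁ m₂ : ℕ) (x : ℝ × ℝ × ℝ) : ℝ × ℝ × ℝ :=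
  (Real.cos x.2.2 * Real.sin (2 * x.2.1), Real.sin x.2.2 * Real.sin (2 * x.2.1),
    Real.sin x.2.2 * Real.sin (2 * x.2.1) *
      (Real.exp (4 / (g : ℝ) * x.1) - mconst g m₁ m₂) +
        2 * Real.cos x.2.2 * lfun m₁ m₂ x.2.1)

theorem hasDerivAt_curve (h : IsSolution g m₁ m₂ ξ θ α) (t : ℝ) :
    HasDerivAt (fun t => (ξ t, θ t, α t)) (field g m₁ m₂ (ξ t, θ t, α t)) t :=
  (h t).1.prodMk ((h t).2.1.prodMk (h t).2.2)

/-- A priori bound for solutions on bounded time intervals, uniform in bounded initial values. -/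
theorem exists_bound (g m₁ m₂ : ℕ) (R T : ℝ) :
    ∃ K, ∀ ξ θ α : ℝ → ℝ, IsSolution g m₁ m₂ ξ θ α → |ξ 0| ≤ R → |θ 0| ≤ R → |α 0| ≤ R →
      ∀ t ∈ Set.Icc 0 T, (ξ t, θ t, α t) ∈ Metric.closedBall (0 : ℝ × ℝ × ℝ) K := by
  set D : ℝ := Real.exp (4 / (g : ℝ) * (R + T)) + |mconst g m₁ m₂| + 2 * (m₁ + m₂) with hD
  refine ⟨max (R + T) (R + D * T), fun ξ θ α h hξ hθ hα => ?_⟩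
  have hprod : ∀ x y : ℝ, |Real.cos x * Real.sin y| ≤ 1 := fun x y => by
    rw [abs_mul]
    exact mul_le_one₀ (Real.abs_cos_le_one _) (abs_nonneg _) (Real.abs_sin_le_one _)
  have hprod' : ∀ x y : ℝ, |Real.sin x * Real.sin y| ≤ 1 := fun x y => by
    rw [abs_mul]
    exact mul_le_one₀ (Real.abs_sin_le_one _) (abs_nonneg _) (Real.abs_sin_le_one _)
  have bound : ∀ {f f' : ℝ → ℝ} {C : ℝ}, (∀ t, HasDerivAt f (f' t) t) →
      (∀ t ∈ Set.Icc 0 T, |f' t| ≤ C) → |f 0| ≤ R → ∀ t ∈ Set.Icc 0 T, |f t| ≤ R + C * t := by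
    intro f f' C hf hC h0 t ht
    have := norm_image_sub_le_of_norm_deriv_le_segment' (a := 0) (b := T) (C := C)
      (fun s _ => (hf s).hasDerivWithinAt) (fun s hs => hC s ⟨hs.1, hs.2.le⟩) t ht
    rw [Real.norm_eq_abs, sub_zero] at this
    linarith [abs_sub_abs_le_abs_sub (f t) (f 0)]
  have h1 := bound (fun t => (h t).1) (fun t _ => hprod _ _) hξ
  have h2 := bound (fun t => (h t).2.1) (fun t _ => hprod' _ _) hθ
  have hD0 : 0 ≤ D := by positivity
  have h3 := bound (C := D) (fun t => (h t).2.2) (fun t ht => by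
    have e1 : Real.exp (4 / (g : ℝ) * ξ t) ≤ Real.exp (4 / (g : ℝ) * (R + T)) := by
      have := le_of_abs_le (h1 t ht)
      have := ht.2
      gcongr
      linarith
    refine (abs_add_le _ _).trans ?_
    rw [abs_mul, abs_mul _ (lfun _ _ _), abs_mul 2]
    have e2 : |Real.exp (4 / (g : ℝ) * ξ t) - mconst g m₁ m₂| ≤
        Real.exp (4 / (g : ℝ) * (R + T)) + |mconst g m₁ m₂| := by
      refine (abs_sub _ _).trans ?_
      rw [abs_of_pos (Real.exp_pos _)]
      linarith
    have e3 := mul_le_mul (hprod' (α t) (2 * θ t)) e2 (abs_nonneg _) zero_le_one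
    have e4 := mul_le_mul (Real.abs_cos_le_one (α t)) (abs_lfun_le m₁ m₂ (θ t))
      (abs_nonneg _) zero_le_one
    rw [abs_of_pos (two_pos : (0 : ℝ) < 2)]
    linarith) hα
  intro t ht
  rw [mem_closedBall_zero_iff, Prod.norm_def, Prod.norm_def]
  have := mul_le_mul_of_nonneg_left ht.2 hD0
  simp only [Real.norm_eq_abs]
  refine max_le ((h1 t ht).trans (le_max_of_le_left (by linarith [ht.2]))) (max_le
    ((h2 t ht).trans (le_max_of_le_left (by linarith [ht.2])))
    ((h3 t ht).trans (le_max_of_le_right (by linarith))))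

end IsSolution

/-- Continuous dependence of the shooting family on its initial value. -/
theorem IsShootingFamily.exists_close {g m₁ m₂ : ℕ} {Ξ Θ A : ℝ → ℝ → ℝ}
    (hfam : IsShootingFamily g m₁ m₂ Ξ Θ A) (c T : ℝ) {ε : ℝ} (hε : 0 < ε) :
    ∃ c' > c, ∀ t ∈ Set.Icc 0 T,
      |Ξ c' t - Ξ c t| ≤ ε ∧ |Θ c' t - Θ c t| ≤ ε ∧ |A c' t - A c t| ≤ ε := by
  set R : ℝ := max (|c| + 1) (max |thetaStar m₁ m₂| |Real.pi / 2|)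
  obtain ⟨K, hK⟩ := IsSolution.exists_bound g m₁ m₂ R T
  have hsm : ContDiffOn ℝ 1 (IsSolution.field g m₁ m₂) (Metric.closedBall 0 K) := by
    unfold IsSolution.field lfun
    fun_prop
  obtain ⟨L, hL⟩ := hsm.exists_lipschitzOnWith one_ne_zero (convex_closedBall _ _)
    (isCompact_closedBall _ _)
  set δ : ℝ := min 1 (ε * Real.exp (-(L * T))) with hδ
  have hδ0 : 0 < δ := lt_min one_pos (by positivity)
  have hmem : ∀ r, |r| ≤ |c| + 1 → ∀ t ∈ Set.Icc 0 T,
      (Ξ r t, Θ r t, A r t) ∈ Metric.closedBall (0 : ℝ × ℝ × ℝ) K := fun r hr =>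
    hK _ _ _ (hfam r).1 (by rw [(hfam r).2.1]; exact hr.trans (le_max_left _ _))
      (by rw [(hfam r).2.2.1]; exact (le_max_left _ _).trans (le_max_right _ _))
      (by rw [(hfam r).2.2.2]; exact (le_max_right _ _).trans (le_max_right _ _))
  have hc' : |c + δ| ≤ |c| + 1 := (abs_add_le _ _).trans (by
    rw [abs_of_pos hδ0]; linarith [min_le_left 1 (ε * Real.exp (-(L * T)))])
  refine ⟨c + δ, by linarith, fun t ht => ?_⟩
  have hd := dist_le_of_trajectories_ODE_of_mem (v := fun _ => IsSolution.field g m₁ m₂)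
    (s := fun _ => Metric.closedBall 0 K) (K := L) (a := 0) (b := T) (δ := δ)
    (f := fun t => (Ξ (c + δ) t, Θ (c + δ) t, A (c + δ) t))
    (g := fun t => (Ξ c t, Θ c t, A c t))
    (fun _ _ => hL)
    (fun t _ => ((hfam (c + δ)).1.hasDerivAt_curve t).continuousAt.continuousWithinAt)
    (fun t _ => ((hfam (c + δ)).1.hasDerivAt_curve t).hasDerivWithinAt)
    (fun t ht => hmem _ hc' t ⟨ht.1, ht.2.le⟩)
    (fun t _ => ((hfam c).1.hasDerivAt_curve t).continuousAt.continuousWithinAt)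
    (fun t _ => ((hfam c).1.hasDerivAt_curve t).hasDerivWithinAt)
    (fun t ht => hmem c (by linarith) t ⟨ht.1, ht.2.le⟩)
    (by simp [(hfam _).2.1, (hfam _).2.2.1, (hfam _).2.2.2, Prod.dist_eq, abs_of_pos hδ0, hδ0.le])
    t ht
  have hle : δ * Real.exp (L * (t - 0)) ≤ ε := by
    have h1 : Real.exp (L * (t - 0)) ≤ Real.exp (L * T) := by
      have := ht.2
      gcongr
      linarith
    calc δ * Real.exp (L * (t - 0)) ≤ (ε * Real.exp (-(L * T))) * Real.exp (L * T) := by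
          gcongr
          exact min_le_right _ _
      _ = ε := by rw [mul_assoc, ← Real.exp_add]; simp
  have hd' := hd.trans hle
  simp only [Prod.dist_eq, Real.dist_eq] at hd'
  exact ⟨(le_max_left _ _).trans hd', (le_max_left _ _).trans ((le_max_right _ _).trans hd'),
    (le_max_right _ _).trans ((le_max_right _ _).trans hd')⟩

namespace IsSolution

variable {g m₁ m₂ : ℕ} {ξ θ α : ℝ → ℝ}

theorem alpha_mem_Ioo (h : IsSolution g m₁ m₂ ξ θ α) (hm₁ : 0 < m₁) (hm₂ : 0 < m₂)
    (hξ : mconst g m₁ m₂ < Real.exp (4 / (g : ℝ) * ξ 0)) (hθ : θ 0 = thetaStar m₁ m₂)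
    (hα : α 0 = Real.pi / 2) {T : ℝ}
    (hne : ∀ t ∈ Set.Ioo 0 T, Real.cos (α t) * Real.sin (2 * θ t) ≠ 0) :
    ∀ t ∈ Set.Ioo 0 T, α t ∈ Set.Ioo (Real.pi / 2) (3 * Real.pi / 2) := by
  have h0 : θ 0 ∈ Set.Ioo 0 (Real.pi / 2) := hθ ▸ ⟨thetaStar_pos hm₁ hm₂, thetaStar_lt m₁ m₂⟩
  have hs := h.sin_two_theta_pos h0 le_rfl
  intro t ht
  constructor
  · have := gt_on_Ioo_of_deriv_pos (a := 0) (b := T) (fun t => (h t).2.2)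
      (by
        rw [hα, Real.sin_pi_div_two, Real.cos_pi_div_two]
        have := mul_pos hs (sub_pos.2 hξ)
        linarith)
      (fun t ht heq => hne t ht (by rw [heq, hα, Real.cos_pi_div_two, zero_mul])) t ht
    rwa [hα] at this
  · refine lt_on_Ioo_of_ne (a := 0) (b := T) h.continuous_alpha.continuousOn
      (by rw [hα]; linarith [Real.pi_pos]) (fun t ht heq => hne t ht ?_) t ht
    rw [heq, show 3 * Real.pi / 2 = Real.pi / 2 + Real.pi by ring, Real.cos_add_pi,
      Real.cos_pi_div_two, neg_zero, zero_mul]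

/-- At `α = π` the angle `α` increases, as long as `θ > θ*`. -/
theorem alpha_ge_pi (h : IsSolution g m₁ m₂ ξ θ α) (hm₁ : 0 < m₁) (hm₂ : 0 < m₂) {a b : ℝ}
    (hθ : ∀ t ∈ Set.Ico a b, θ t ∈ Set.Ioo (thetaStar m₁ m₂) (Real.pi / 2))
    (ha : Real.pi ≤ α a) : ∀ t ∈ Set.Icc a b, Real.pi ≤ α t :=
  ge_on_Icc_of_deriv_pos (fun t => (h t).2.2) ha fun t ht heq => by
    have := lfun_neg hm₁ hm₂ (hθ t ht).1 (hθ t ht).2.le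
    rw [heq, Real.sin_pi, Real.cos_pi]
    linarith

theorem sin_nonpos_of_mem {x : ℝ} (hx : x ∈ Set.Icc Real.pi (3 * Real.pi / 2)) :
    Real.sin x ≤ 0 := by
  have := Real.sin_nonneg_of_nonneg_of_le_pi (x := x - Real.pi) (by linarith [hx.1])
    (by linarith [hx.2, Real.pi_pos])
  rw [Real.sin_sub_pi] at this
  linarith

theorem cos_nonpos_of_mem {x : ℝ} (hx : x ∈ Set.Icc (Real.pi / 2) (3 * Real.pi / 2)) :
    Real.cos x ≤ 0 :=
  Real.cos_nonpos_of_pi_div_two_le_of_le hx.1 (by linarith [hx.2])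

/-- A solution cannot stay forever in the region `π ≤ α < 3π/2`, `θ > θ*`. -/
theorem not_forall_alpha_ge_pi (h : IsSolution g m₁ m₂ ξ θ α) (hg : 0 < g) (hm₁ : 0 < m₁)
    (hm₂ : 0 < m₂) {a : ℝ} (hα : ∀ t ≥ a, α t ∈ Set.Ico Real.pi (3 * Real.pi / 2))
    (hθ : ∀ t ≥ a, θ t ∈ Set.Ioo (thetaStar m₁ m₂) (Real.pi / 2)) : False := by
  have hg' : (0 : ℝ) < g := by exact_mod_cast hg
  have hm : 0 < mconst g m₁ m₂ := by unfold mconst; positivity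
  have hpi := Real.pi_pos
  have hsin : ∀ t ≥ a, Real.sin (α t) ≤ 0 := fun t ht =>
    sin_nonpos_of_mem ⟨(hα t ht).1, (hα t ht).2.le⟩
  have hcos : ∀ t ≥ a, Real.cos (α t) ≤ 0 := fun t ht =>
    cos_nonpos_of_mem ⟨by linarith [(hα t ht).1], (hα t ht).2.le⟩
  have hs2 : ∀ t ≥ a, 0 < Real.sin (2 * θ t) := fun t ht =>
    Real.sin_pos_of_pos_of_lt_pi (by linarith [(hθ t ht).1, thetaStar_pos hm₁ hm₂])
      (by linarith [(hθ t ht).2])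
  have hθa : ∀ t ≥ a, θ t ≤ θ a := fun t ht => by
    have := le_of_hasDerivAt_nonneg ht (fun s => (h s).2.1.neg) fun s hs => by
      have := mul_nonpos_of_nonpos_of_nonneg (hsin s hs.1.le) (hs2 s hs.1.le).le
      linarith
    simp only [Pi.neg_apply] at this
    linarith
  obtain ⟨σ, hσ, hσle⟩ := exists_sin_two_mul_ge (thetaStar_pos hm₁ hm₂) (hθ a le_rfl).2
  have hσ' : ∀ t ≥ a, σ ≤ Real.sin (2 * θ t) := fun t ht =>
    hσle _ ⟨(hθ t ht).1.le, hθa t ht⟩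
  have hsum : ∀ t ≥ a, ξ t ≤ ξ a + θ a - thetaStar m₁ m₂ - σ * (t - a) := fun t ht => by
    have := le_of_hasDerivAt_ge (c := σ) ht (fun s => ((h s).1.add (h s).2.1).neg) fun s hs => by
      have h1 := hsin s hs.1.le
      have h2 := hcos s hs.1.le
      have h3 : Real.sin (α s) + Real.cos (α s) ≤ -1 := by
        nlinarith [Real.sin_sq_add_cos_sq (α s), mul_nonneg_of_nonpos_of_nonpos h1 h2]
      nlinarith [hσ' s hs.1.le]
    simp only [Pi.neg_apply, Pi.add_apply] at this
    linarith [(hθ t ht).1]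
  set X : ℝ := g / 4 * Real.log (mconst g m₁ m₂) with hX
  have hE : ∀ x ≤ X, Real.exp (4 / (g : ℝ) * x) ≤ mconst g m₁ m₂ := fun x hx => by
    rw [← Real.le_log_iff_exp_le hm]
    calc 4 / (g : ℝ) * x ≤ 4 / g * X := by gcongr
      _ = Real.log (mconst g m₁ m₂) := by rw [hX]; field_simp
  set b : ℝ := a + 1 + |ξ a + θ a - thetaStar m₁ m₂ - X| / σ with hb
  have hb0 : a < b := by
    have : 0 ≤ |ξ a + θ a - thetaStar m₁ m₂ - X| / σ := by positivity
    linarith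
  have hEb : ∀ t ≥ b, Real.exp (4 / (g : ℝ) * ξ t) - mconst g m₁ m₂ ≤ 0 := fun t ht => by
    refine sub_nonpos.2 (hE _ ((hsum t (hb0.le.trans ht)).trans ?_))
    have h1 : |ξ a + θ a - thetaStar m₁ m₂ - X| = σ * (b - a - 1) := by
      rw [hb]; field_simp; ring
    have h2 := le_abs_self (ξ a + θ a - thetaStar m₁ m₂ - X)
    nlinarith [mul_le_mul_of_nonneg_left ht hσ.le]
  have hαb : Real.pi < α b := by
    refine lt_of_le_of_ne (hα b hb0.le).1 fun heq => ?_
    have hmin : IsLocalMin α b := by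
      filter_upwards [Ioi_mem_nhds hb0] with t ht
      rw [← heq]
      exact (hα t (le_of_lt ht)).1
    have h1 := hmin.hasDerivAt_eq_zero (h b).2.2
    have h2 := lfun_neg hm₁ hm₂ (hθ b hb0.le).1 (hθ b hb0.le).2.le
    rw [← heq, Real.sin_pi, Real.cos_pi] at h1
    linarith
  have hαmono : ∀ t ≥ b, α b ≤ α t := fun t ht =>
    le_of_hasDerivAt_nonneg ht (fun s => (h s).2.2) fun s hs => by
      have hsa : a ≤ s := by linarith [hs.1]
      have h1 := mul_nonneg_of_nonpos_of_nonpos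
        (mul_nonpos_of_nonpos_of_nonneg (hsin s hsa) (hs2 s hsa).le) (hEb s hs.1.le)
      have h2 := mul_nonneg_of_nonpos_of_nonpos (hcos s hsa)
        (lfun_neg hm₁ hm₂ (hθ s hsa).1 (hθ s hsa).2.le).le
      linarith
  have hsb : ∀ t ≥ b, Real.sin (α t) ≤ Real.sin (α b) := fun t ht => by
    have hta : a ≤ t := hb0.le.trans ht
    have := Real.sin_le_sin_of_le_of_le_pi_div_two (x := α b - Real.pi) (y := α t - Real.pi)
      (by linarith) (by linarith [(hα t hta).2]) (by linarith [hαmono t ht])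
    rw [Real.sin_sub_pi, Real.sin_sub_pi] at this
    linarith
  have hsb0 : Real.sin (α b) < 0 := by
    have := Real.sin_pos_of_pos_of_lt_pi (x := α b - Real.pi) (by linarith)
      (by linarith [(hα b hb0.le).2])
    rw [Real.sin_sub_pi] at this
    linarith
  have hk : 0 < -Real.sin (α b) * σ := mul_pos (by linarith) hσ
  set t : ℝ := b + Real.pi / (-Real.sin (α b) * σ) with ht
  have htb : b ≤ t := by
    have : 0 ≤ Real.pi / (-Real.sin (α b) * σ) := by positivity
    linarith
  have := le_of_hasDerivAt_ge (c := -Real.sin (α b) * σ) htb (fun s => (h s).2.1.neg)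
    fun s hs => by
      have hsa : a ≤ s := by linarith [hs.1]
      nlinarith [hσ' s hsa, hsb s hs.1.le]
  rw [show -Real.sin (α b) * σ * (t - b) = Real.pi by
    have := hsb0.ne
    rw [ht, add_sub_cancel_left]
    field_simp] at this
  simp only [Pi.neg_apply] at this
  linarith [(hθ t (hb0.le.trans htb)).1, (hθ b hb0.le).2, thetaStar_pos hm₁ hm₂]

/-- A solution staying in the region `π/2 < α < π`, `θ > θ*` reaches values of `ξ` below that of
the cylinder and gets arbitrarily close to the axis `θ = π/2`. -/
theorem exists_near_axis (h : IsSolution g m₁ m₂ ξ θ α) (hg : 0 < g) (hm₁ : 0 < m₁)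
    (hm₂ : 0 < m₂) (hα : ∀ t > 0, α t ∈ Set.Ioo (Real.pi / 2) Real.pi)
    (hθ : ∀ t > 0, θ t ∈ Set.Ioo (thetaStar m₁ m₂) (Real.pi / 2)) :
    ∃ δ > 0, ∀ ε > 0, ∃ t > 0,
      Real.exp (4 / (g : ℝ) * ξ t) - mconst g m₁ m₂ ≤ -δ ∧ Real.pi / 2 - ε < θ t := by
  have hg' : (0 : ℝ) < g := by exact_mod_cast hg
  have hpi := Real.pi_pos
  have hsin : ∀ t > 0, 0 < Real.sin (α t) := fun t ht =>
    Real.sin_pos_of_pos_of_lt_pi (by linarith [(hα t ht).1]) (hα t ht).2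
  have hcos : ∀ t > 0, Real.cos (α t) < 0 := fun t ht =>
    Real.cos_neg_of_pi_div_two_lt_of_lt (hα t ht).1 (by linarith [(hα t ht).2])
  have hs2 : ∀ t > 0, 0 < Real.sin (2 * θ t) := fun t ht =>
    Real.sin_pos_of_pos_of_lt_pi (by linarith [(hθ t ht).1, thetaStar_pos hm₁ hm₂])
      (by linarith [(hθ t ht).2])
  have hθ1 : ∀ t ≥ 1, θ 1 ≤ θ t := fun t ht =>
    le_of_hasDerivAt_nonneg ht (fun s => (h s).2.1) fun s hs =>
      (mul_pos (hsin s (by linarith [hs.1])) (hs2 s (by linarith [hs.1]))).le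
  have hl1 := lfun_neg hm₁ hm₂ (hθ 1 one_pos).1 (hθ 1 one_pos).2.le
  have hl : ∀ t ≥ 1, lfun m₁ m₂ (θ t) ≤ lfun m₁ m₂ (θ 1) := fun t ht => by
    rcases (hθ1 t ht).eq_or_lt with heq | hlt
    · rw [heq]
    · exact (lfun_lt hm₁ (by linarith [(hθ 1 one_pos).1, thetaStar_pos hm₁ hm₂]) hlt
        (hθ t (by linarith)).2.le).le
  have hneg : ∃ b ≥ 1, Real.exp (4 / (g : ℝ) * ξ b) - mconst g m₁ m₂ < 0 := by
    by_contra! hE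
    have hterm : ∀ s ≥ 1, 0 ≤ Real.sin (α s) * Real.sin (2 * θ s) *
        (Real.exp (4 / (g : ℝ) * ξ s) - mconst g m₁ m₂) := fun s hs =>
      mul_nonneg (mul_pos (hsin s (by linarith)) (hs2 s (by linarith))).le (hE s hs)
    have hmono : ∀ t ≥ 1, α 1 ≤ α t := fun t ht =>
      le_of_hasDerivAt_nonneg ht (fun s => (h s).2.2) fun s hs => by
        have h2 := mul_nonneg_of_nonpos_of_nonpos (hcos s (by linarith [hs.1])).le
          (lfun_neg hm₁ hm₂ (hθ s (by linarith [hs.1])).1 (hθ s (by linarith [hs.1])).2.le).le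
        linarith [hterm s hs.1.le]
    have hk : 0 < 2 * (Real.cos (α 1) * lfun m₁ m₂ (θ 1)) := by
      have := mul_pos_of_neg_of_neg (hcos 1 one_pos) hl1
      linarith
    set k : ℝ := 2 * (Real.cos (α 1) * lfun m₁ m₂ (θ 1))
    have ht1 : 1 ≤ 1 + Real.pi / k := by
      have : 0 ≤ Real.pi / k := by positivity
      linarith
    have := le_of_hasDerivAt_ge (c := k) ht1 (fun s => (h s).2.2) fun s hs => by
      have hc : Real.cos (α s) ≤ Real.cos (α 1) :=
        Real.cos_le_cos_of_nonneg_of_le_pi (by linarith [(hα 1 one_pos).1])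
          (hα s (by linarith [hs.1])).2.le (hmono s hs.1.le)
      have := mul_le_mul_of_nonpos_of_nonpos hc (hl s hs.1.le)
        (hcos s (by linarith [hs.1])).le hl1.le
      linarith [hterm s hs.1.le]
    rw [show k * (1 + Real.pi / k - 1) = Real.pi by field_simp; ring] at this
    linarith [(hα 1 one_pos).1, (hα (1 + Real.pi / k) (by linarith)).2]
  obtain ⟨b, hb1, hb⟩ := hneg
  refine ⟨_, neg_pos.2 hb, fun ε hε => ?_⟩
  suffices hex : ∃ t ≥ b, Real.pi / 2 - ε < θ t by
    obtain ⟨t, htb, ht⟩ := hex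
    refine ⟨t, by linarith, ?_, ht⟩
    have := le_of_hasDerivAt_nonneg htb (fun s => (h s).1.neg) fun s hs => by
      have := mul_neg_of_neg_of_pos (hcos s (by linarith [hs.1])) (hs2 s (by linarith [hs.1]))
      linarith
    simp only [Pi.neg_apply] at this
    rw [neg_neg]
    have hξ : ξ t ≤ ξ b := by linarith
    gcongr
  by_contra! hθε
  obtain ⟨σ, hσ, hσle⟩ := exists_sin_two_mul_ge (thetaStar_pos hm₁ hm₂)
    (sub_lt_self (Real.pi / 2) hε)
  set k : ℝ := min σ (-2 * lfun m₁ m₂ (θ 1)) with hk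
  have hk0 : 0 < k := lt_min hσ (by linarith)
  set M : ℝ := mconst g m₁ m₂ + 1 with hM
  have hM0 : 0 < M := by rw [hM]; unfold mconst; positivity
  set L : ℝ := Real.pi / 2 + M * (Real.pi / 2) with hL
  have htb : b ≤ b + L / k := by
    have : 0 ≤ L / k := by positivity
    linarith
  have := le_of_hasDerivAt_ge (c := k) htb (fun s => (h s).2.2.add ((h s).2.1.const_mul M))
    fun s hs => by
      have hs0 : 0 < s := by linarith [hs.1]
      have hs1 : 1 ≤ s := by linarith [hs.1]
      have h1 := hsin s hs0
      have h2 := hcos s hs0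
      have h3 : 1 ≤ Real.sin (α s) - Real.cos (α s) := by
        nlinarith [Real.sin_sq_add_cos_sq (α s), mul_pos_of_neg_of_neg h2 (neg_neg_of_pos h1)]
      have h4 : k ≤ Real.sin (2 * θ s) :=
        (min_le_left _ _).trans (hσle _ ⟨(hθ s hs0).1.le, hθε s hs.1.le⟩)
      have h5 : k ≤ -2 * lfun m₁ m₂ (θ s) :=
        (min_le_right _ _).trans (by linarith [hl s hs1])
      have h6 := mul_pos (mul_pos h1 (hs2 s hs0)) (Real.exp_pos (4 / (g : ℝ) * ξ s))
      have h7 := mul_le_mul_of_nonneg_left h4 h1.le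
      have h8 := mul_le_mul_of_nonneg_left h5 (neg_nonneg.2 h2.le)
      rw [hM]
      nlinarith
  rw [show k * (b + L / k - b) = L by field_simp; ring] at this
  simp only [Pi.add_apply] at this
  have hp1 := hα b (by linarith)
  have hp2 := hα (b + L / k) (by linarith)
  have hp3 := (hθ b (by linarith)).1
  have hp4 := (hθ (b + L / k) (by linarith)).2
  have := mul_lt_mul_of_pos_left hp4 hM0
  have := mul_pos hM0 ((thetaStar_pos hm₁ hm₂).trans hp3)
  linarith [hp1.1, hp2.2]

/-- If `α` increases with speed at least `κ`, by at most `π/2` in total, then the distance to the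
axis `θ = π/2` grows at most by the factor `exp (π / κ)`. -/
theorem axis_dist_le (h : IsSolution g m₁ m₂ ξ θ α) {κ a b : ℝ} (hκ : 0 < κ) (hab : a ≤ b)
    (hs : ∀ t ∈ Set.Ioo a b, 0 < Real.sin (2 * θ t)) (hθ : ∀ t ∈ Set.Icc a b, θ t < Real.pi / 2)
    (hα : ∀ t ∈ Set.Ioo a b, κ ≤ Real.sin (α t) * Real.sin (2 * θ t) *
      (Real.exp (4 / (g : ℝ) * ξ t) - mconst g m₁ m₂) +
        2 * Real.cos (α t) * lfun m₁ m₂ (θ t)) (hαab : α b ≤ α a + Real.pi / 2) :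
    Real.pi / 2 - θ b ≤ (Real.pi / 2 - θ a) * Real.exp (Real.pi / κ) := by
  have hexp := le_of_hasDerivAt_nonneg hab (fun t => (((h t).2.1.const_sub (Real.pi / 2)).mul
    (((h t).2.2.const_mul (-(2 / κ))).exp)).neg) fun t ht => by
      have h1 := hα t ht
      set d : ℝ := Real.sin (α t) * Real.sin (2 * θ t) *
        (Real.exp (4 / (g : ℝ) * ξ t) - mconst g m₁ m₂) +
          2 * Real.cos (α t) * lfun m₁ m₂ (θ t)
      have hθt := hθ t (Set.Ioo_subset_Icc_self ht)
      have h2 : 2 ≤ 2 / κ * d := by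
        rw [div_mul_eq_mul_div, le_div_iff₀ hκ]
        linarith
      have h3 : Real.sin (2 * θ t) ≤ Real.pi - 2 * θ t := by
        rw [← Real.sin_pi_sub]
        exact Real.sin_le (by linarith)
      have h4 : -Real.sin (2 * θ t) ≤ Real.sin (α t) * Real.sin (2 * θ t) := by
        nlinarith [Real.neg_one_le_sin (α t), hs t ht]
      have h5 := mul_le_mul_of_nonneg_right h2 (sub_nonneg.2 hθt.le)
      have h6 : 0 ≤ Real.sin (α t) * Real.sin (2 * θ t) +
          2 / κ * d * (Real.pi / 2 - θ t) := by linarith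
      have h7 := mul_nonneg h6 (Real.exp_nonneg (-(2 / κ) * α t))
      linarith
  simp only [Pi.neg_apply, Pi.mul_apply, neg_le_neg_iff] at hexp
  have hpos : 0 ≤ Real.pi / 2 - θ a := sub_nonneg.2 (hθ a ⟨le_rfl, hab⟩).le
  have hle : Real.exp (-(2 / κ) * α a) ≤ Real.exp (Real.pi / κ) * Real.exp (-(2 / κ) * α b) := by
    rw [← Real.exp_add, Real.exp_le_exp,
      show Real.pi / κ = 2 / κ * (Real.pi / 2) by field_simp]
    have := mul_le_mul_of_nonneg_left hαab (by positivity : 0 ≤ 2 / κ)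
    linarith
  refine le_of_mul_le_mul_right ?_ (Real.exp_pos (-(2 / κ) * α b))
  calc _ ≤ _ := hexp
    _ ≤ _ := by rw [mul_assoc]; gcongr

/-- A solution that turns around at `α = π` very close to the axis `θ = π/2` and below the cylinder
cannot come back to `θ*` before `α` exceeds `3π/2`. -/
theorem no_return_of_turn_near_axis (g : ℕ) (hm₁ : 0 < m₁) (hm₂ : 0 < m₂) {δ : ℝ} (hδ : 0 < δ) :
    ∃ ε > 0, ε ≤ Real.pi / 2 - thetaStar m₁ m₂ ∧
      ∀ ξ θ α : ℝ → ℝ, IsSolution g m₁ m₂ ξ θ α → ∀ s T' : ℝ, s < T' →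
      (∀ t ∈ Set.Ico s T', θ t ∈ Set.Ioo (thetaStar m₁ m₂) (Real.pi / 2)) →
      θ T' = thetaStar m₁ m₂ → α s = Real.pi →
      (∀ t ∈ Set.Icc s T', α t ∈ Set.Icc Real.pi (3 * Real.pi / 2)) →
      (∀ t ∈ Set.Ioo s T', Real.exp (4 / (g : ℝ) * ξ t) - mconst g m₁ m₂ ≤ -δ) →
      Real.pi / 2 - ε < θ s → False := by
  have hpi := Real.pi_pos
  have hst0 := thetaStar_pos hm₁ hm₂
  have hst1 := thetaStar_lt m₁ m₂
  set θ₁ : ℝ := (thetaStar m₁ m₂ + Real.pi / 2) / 2 with hθ₁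
  have hθ₁0 : thetaStar m₁ m₂ < θ₁ := by linarith
  have hθ₁1 : θ₁ < Real.pi / 2 := by linarith
  have hl1 := lfun_neg hm₁ hm₂ hθ₁0 hθ₁1.le
  set η : ℝ := min 1 (δ * (θ₁ - thetaStar m₁ m₂) / 2) with hη
  have hη0 : 0 < η := lt_min one_pos (div_pos (mul_pos hδ (by linarith)) two_pos)
  have hη1 : η ≤ 1 := min_le_left _ _
  have hη2 : 2 * η ≤ δ * (θ₁ - thetaStar m₁ m₂) := by
    linarith [min_le_right 1 (δ * (θ₁ - thetaStar m₁ m₂) / 2)]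
  have hsη : 0 < Real.sin η := Real.sin_pos_of_pos_of_lt_pi hη0 (by linarith [Real.pi_gt_three])
  set κ : ℝ := 2 * (Real.sin η * -lfun m₁ m₂ θ₁) with hκ
  have hκ0 : 0 < κ := mul_pos two_pos (mul_pos hsη (by linarith))
  set ε : ℝ := (Real.pi / 2 - θ₁) * Real.exp (-(Real.pi / κ)) with hε
  have hε0 : 0 < ε := mul_pos (by linarith) (Real.exp_pos _)
  have hε1 : ε ≤ Real.pi / 2 - θ₁ := by
    refine mul_le_of_le_one_right (by linarith) (Real.exp_le_one_iff.2 ?_)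
    have : 0 ≤ Real.pi / κ := by positivity
    linarith
  refine ⟨ε, hε0, by linarith, fun ξ θ α h s T' hsT' hθ hθT' hαs hα hEneg hθs' => ?_⟩
  have hθs : θ₁ < θ s := by linarith
  obtain ⟨c, hsc, hcT', hθc, hθgt₁⟩ := exists_first_hit hsT'.le h.continuous_theta hθs
    (hθT'.trans_lt hθ₁0).le
  have hs2 : ∀ t ∈ Set.Ioo s T', 0 < Real.sin (2 * θ t) := fun t ht => by
    have := hθ t ⟨ht.1.le, ht.2⟩
    exact Real.sin_pos_of_pos_of_lt_pi (by linarith [this.1]) (by linarith [this.2])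
  have hθ' : ∀ t ∈ Set.Ioo s T', Real.sin (α t) * Real.sin (2 * θ t) ≤ 0 := fun t ht =>
    mul_nonpos_of_nonpos_of_nonneg (sin_nonpos_of_mem (hα t (Set.Ioo_subset_Icc_self ht)))
      (hs2 t ht).le
  have hθ'E : ∀ t ∈ Set.Ioo s T', δ * -(Real.sin (α t) * Real.sin (2 * θ t)) ≤
      Real.sin (α t) * Real.sin (2 * θ t) *
        (Real.exp (4 / (g : ℝ) * ξ t) - mconst g m₁ m₂) := fun t ht => by
    linarith [mul_le_mul_of_nonpos_left (hEneg t ht) (hθ' t ht)]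
  have hcl : ∀ t ∈ Set.Ioo s T', 0 ≤ Real.cos (α t) * lfun m₁ m₂ (θ t) := fun t ht => by
    have h1 := hα t (Set.Ioo_subset_Icc_self ht)
    have h2 := hθ t ⟨ht.1.le, ht.2⟩
    exact mul_nonneg_of_nonpos_of_nonpos (cos_nonpos_of_mem ⟨by linarith [h1.1], h1.2⟩)
      (lfun_neg hm₁ hm₂ h2.1 h2.2.le).le
  have hfinal := le_of_hasDerivAt_nonneg hcT'
    (fun t => (h t).2.2.add ((h t).2.1.const_mul δ)) fun t ht => by
      have ht' : t ∈ Set.Ioo s T' := ⟨hsc.trans ht.1, ht.2⟩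
      linarith [hcl t ht', hθ'E t ht']
  simp only [Pi.add_apply] at hfinal
  rw [hθT', hθc] at hfinal
  have hαc : α c < 3 * Real.pi / 2 - η := by
    linarith [(hα T' ⟨hsT'.le, le_rfl⟩).2]
  have hαmono : ∀ t ∈ Set.Ioo s c, α t ≤ α c := fun t ht =>
    le_of_hasDerivAt_nonneg ht.2.le (fun r => (h r).2.2) fun r hr => by
      have hr' : r ∈ Set.Ioo s T' := ⟨ht.1.trans hr.1, hr.2.trans_le hcT'⟩
      linarith [hcl r hr', hθ'E r hr', mul_nonneg hδ.le (neg_nonneg.2 (hθ' r hr'))]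
  have hα' : ∀ t ∈ Set.Ioo s c, κ ≤ Real.sin (α t) * Real.sin (2 * θ t) *
      (Real.exp (4 / (g : ℝ) * ξ t) - mconst g m₁ m₂) +
        2 * Real.cos (α t) * lfun m₁ m₂ (θ t) := fun t ht => by
    have ht' : t ∈ Set.Ioo s T' := ⟨ht.1, ht.2.trans_le hcT'⟩
    have h1 : Real.sin η ≤ -Real.cos (α t) := by
      have := Real.cos_le_cos_of_nonneg_of_le_pi (x := α t - Real.pi) (y := Real.pi / 2 - η)
        (by linarith [(hα t (Set.Ioo_subset_Icc_self ht')).1]) (by linarith) (by linarith [hαmono t ht])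
      rwa [Real.cos_pi_div_two_sub, Real.cos_sub_pi] at this
    have h2 := lfun_lt (m₂ := m₂) hm₁ (by linarith) (hθgt₁ t ⟨ht.1.le, ht.2⟩)
      (hθ t ⟨ht'.1.le, ht'.2⟩).2.le
    have h3 := mul_le_mul h1 (neg_le_neg h2.le) (by linarith) (hsη.le.trans h1)
    have h4 := mul_nonneg_of_nonpos_of_nonpos (hθ' t ht') ((hEneg t ht').trans (by linarith))
    linarith
  have hθlt : ∀ t ∈ Set.Icc s c, θ t < Real.pi / 2 := fun t ht => by
    rcases ht.2.eq_or_lt with rfl | h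
    · rwa [hθc]
    · exact (hθ t ⟨ht.1, h.trans_le hcT'⟩).2
  have hgrow := h.axis_dist_le hκ0 hsc.le (fun t ht => hs2 t ⟨ht.1, ht.2.trans_le hcT'⟩)
    hθlt hα' (by linarith)
  rw [hθc] at hgrow
  have : (Real.pi / 2 - θ s) * Real.exp (Real.pi / κ) < Real.pi / 2 - θ₁ := by
    calc (Real.pi / 2 - θ s) * Real.exp (Real.pi / κ) < ε * Real.exp (Real.pi / κ) := by
          gcongr
          linarith
      _ = Real.pi / 2 - θ₁ := by rw [hε, mul_assoc, ← Real.exp_add]; simp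
  linarith

/-- A solution that comes very close to the axis `θ = π/2` below the cylinder cannot come back to
`θ*` before `α` reaches `3π/2`. -/
theorem no_return_of_near_axis (g : ℕ) (hm₁ : 0 < m₁) (hm₂ : 0 < m₂) {δ : ℝ} (hδ : 0 < δ) :
    ∃ ε > 0, ∀ ξ θ α : ℝ → ℝ, IsSolution g m₁ m₂ ξ θ α → θ 0 = thetaStar m₁ m₂ →
      ∀ T > 0, θ T = thetaStar m₁ m₂ →
      (∀ t ∈ Set.Ioo 0 T, α t ∈ Set.Ioo (Real.pi / 2) (3 * Real.pi / 2)) →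
      ∀ a > 0, (∀ t ∈ Set.Ioc 0 a, α t < Real.pi) →
      Real.exp (4 / (g : ℝ) * ξ a) - mconst g m₁ m₂ ≤ -δ → Real.pi / 2 - ε < θ a → False := by
  have hpi := Real.pi_pos
  have hst0 := thetaStar_pos hm₁ hm₂
  have hst1 := thetaStar_lt m₁ m₂
  obtain ⟨ε, hε0, hε1, hturn⟩ := no_return_of_turn_near_axis g hm₁ hm₂ hδ
  refine ⟨ε, hε0, fun ξ θ α h h0 T hT hθT hα a ha hαa hE hθa => ?_⟩
  have h0' : θ 0 ∈ Set.Ioo 0 (Real.pi / 2) := h0 ▸ ⟨hst0, hst1⟩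
  have hs2 : ∀ t > 0, 0 < Real.sin (2 * θ t) := fun t ht => h.sin_two_theta_pos h0' ht.le
  have hcrit : ∀ s ∈ Set.Ioo 0 T, Real.sin (α s) * Real.sin (2 * θ s) = 0 →
      α s = Real.pi ∧ a < s := fun s hs hz => by
    have h1 := (mul_eq_zero.1 hz).resolve_right (hs2 s hs.1).ne'
    have h2 := (Real.sin_eq_zero_iff_of_lt_of_lt (x := α s - Real.pi)
      (by linarith [(hα s hs).1]) (by linarith [(hα s hs).2])).1
      (by rw [Real.sin_sub_pi, h1, neg_zero])
    refine ⟨by linarith, ?_⟩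
    by_contra! hsa
    linarith [hαa s ⟨hs.1, hsa⟩]
  obtain ⟨r, hr, hr0⟩ := exists_hasDerivAt_eq_zero hT h.continuous_theta.continuousOn
    (h0.trans hθT.symm) fun s _ => (h s).2.1
  have haT : a < T := (hcrit r hr hr0).2.trans hr.2
  obtain ⟨s, hs, hmax⟩ := isCompact_Icc.exists_isMaxOn (Set.nonempty_Icc.2 hT.le)
    h.continuous_theta.continuousOn
  have hθas : θ a ≤ θ s := hmax ⟨ha.le, haT.le⟩
  have hθs : thetaStar m₁ m₂ < θ s := by linarith
  have hs0 : 0 < s := lt_of_le_of_ne hs.1 fun heq => by rw [← heq, h0] at hθs; linarith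
  have hsT : s < T := lt_of_le_of_ne hs.2 fun heq => by rw [heq, hθT] at hθs; linarith
  obtain ⟨hαs, has⟩ := hcrit s ⟨hs0, hsT⟩
    ((hmax.isLocalMax (Icc_mem_nhds hs0 hsT)).hasDerivAt_eq_zero (h s).2.1)
  obtain ⟨T', hsT', hT'T, hθT', hθgt⟩ := exists_first_hit hsT.le h.continuous_theta
    hθs hθT.le
  have hαle : ∀ t ∈ Set.Icc 0 T, α t ≤ 3 * Real.pi / 2 := by
    rw [← closure_Ioo hT.ne]
    exact closure_minimal (fun t ht => (hα t ht).2.le) (isClosed_Iic.preimage h.continuous_alpha)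
  have hθlt : ∀ t > 0, θ t < Real.pi / 2 := fun t ht => (h.theta_mem_Ioo h0' t ht.le).2
  have hαge := h.alpha_ge_pi hm₁ hm₂ (a := s) (b := T')
    (fun t ht => ⟨hθgt t ht, hθlt t (hs0.trans_le ht.1)⟩) hαs.ge
  have hEneg : ∀ t ∈ Set.Ioo s T',
      Real.exp (4 / (g : ℝ) * ξ t) - mconst g m₁ m₂ ≤ -δ := fun t ht => by
    have hat : a ≤ t := by linarith [ht.1]
    have hξ := le_of_hasDerivAt_nonneg hat (fun r => (h r).1.neg) fun r hr => by
      have hr0 : 0 < r := ha.trans hr.1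
      have hc := mul_nonneg (neg_nonneg.2 (cos_nonpos_of_mem
        (Set.Ioo_subset_Icc_self (hα r ⟨hr0, by linarith [hr.2, ht.2]⟩)))) (hs2 r hr0).le
      linarith
    simp only [Pi.neg_apply] at hξ
    have : ξ t ≤ ξ a := by linarith
    refine le_trans ?_ hE
    gcongr
  exact hturn ξ θ α h s T' hsT' (fun t ht => ⟨hθgt t ht, hθlt t (hs0.trans_le ht.1)⟩) hθT' hαs
    (fun t ht => ⟨hαge t ht, hαle t ⟨hs0.le.trans ht.1, ht.2.trans hT'T⟩⟩) hEneg (by linarith)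

/-- A solution of type 3 starting outside the cylinder keeps `π/2 < α < π` and `θ* < θ < π/2`. -/
theorem alpha_lt_pi_of_type_three (h : IsSolution g m₁ m₂ ξ θ α) (hg : 0 < g) (hm₁ : 0 < m₁)
    (hm₂ : 0 < m₂) (hξ : mconst g m₁ m₂ < Real.exp (4 / (g : ℝ) * ξ 0))
    (hθ0 : θ 0 = thetaStar m₁ m₂) (hα0 : α 0 = Real.pi / 2)
    (hne : ∀ t > 0, Real.cos (α t) * Real.sin (2 * θ t) ≠ 0)
    (hθne : ∀ t > 0, θ t ≠ thetaStar m₁ m₂) :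
    (∀ t > 0, α t ∈ Set.Ioo (Real.pi / 2) Real.pi) ∧
      ∀ t > 0, θ t ∈ Set.Ioo (thetaStar m₁ m₂) (Real.pi / 2) := by
  have h0 : θ 0 ∈ Set.Ioo 0 (Real.pi / 2) := hθ0 ▸ ⟨thetaStar_pos hm₁ hm₂, thetaStar_lt m₁ m₂⟩
  have hα : ∀ t > 0, α t ∈ Set.Ioo (Real.pi / 2) (3 * Real.pi / 2) := fun t ht =>
    h.alpha_mem_Ioo hm₁ hm₂ hξ hθ0 hα0 (fun s hs => hne s hs.1) t ⟨ht, lt_add_one t⟩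
  have hθ : ∀ t > 0, θ t ∈ Set.Ioo (thetaStar m₁ m₂) (Real.pi / 2) := fun t ht => by
    refine ⟨?_, (h.theta_mem_Ioo h0 t ht.le).2⟩
    rw [← hθ0]
    exact gt_on_Ioo_of_deriv_pos (a := 0) (b := t + 1) (fun t => (h t).2.1)
      (by rw [hα0, Real.sin_pi_div_two, one_mul]; exact h.sin_two_theta_pos h0 le_rfl)
      (fun s hs => hθ0 ▸ hθne s hs.1) t ⟨ht, lt_add_one t⟩
  refine ⟨fun t ht => ⟨(hα t ht).1, ?_⟩, hθ⟩
  by_contra! hge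
  exact h.not_forall_alpha_ge_pi hg hm₁ hm₂ (a := t)
    (fun s hs => ⟨h.alpha_ge_pi hm₁ hm₂ (fun r hr => hθ r (ht.trans_le hr.1)) hge s ⟨hs, le_rfl⟩,
      (hα s (ht.trans_le hs)).2⟩) (fun s hs => hθ s (ht.trans_le hs))

end IsSolution

/-- Proposition 3.2 (iii): `ξ₀*` is not of type 3, i.e. for the solution with
initial condition `(ξ₀*, θ*, π/2)` there is some `t > 0` with `ξ'(t) = 0` or
`θ(t) = θ*`. -/
theorem stmt11 (g m₁ m₂ : ℕ) (hg : g = 1 ∨ g = 2 ∨ g = 3 ∨ g = 4 ∨ g = 6)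
    (hm₁ : 0 < m₁) (hm₂ : 0 < m₂)
    (Ξ Θ A : ℝ → ℝ → ℝ) (hfam : IsShootingFamily g m₁ m₂ Ξ Θ A)
    (hne : {r : ℝ | ∀ ξ₀ > r, Type1 m₁ m₂ Ξ Θ A ξ₀}.Nonempty)
    (hbdd : BddBelow {r : ℝ | ∀ ξ₀ > r, Type1 m₁ m₂ Ξ Θ A ξ₀}) :
    ∃ t > (0 : ℝ),
      Real.cos (A (xiStar m₁ m₂ Ξ Θ A) t) *
          Real.sin (2 * Θ (xiStar m₁ m₂ Ξ Θ A) t) = 0 ∨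
        Θ (xiStar m₁ m₂ Ξ Θ A) t = thetaStar m₁ m₂ := by
  have hg0 : 0 < g := by omega
  have hg' : (0 : ℝ) < g := by exact_mod_cast hg0
  have hm : 0 < mconst g m₁ m₂ := by unfold mconst; positivity
  set X : ℝ := g / 4 * Real.log (mconst g m₁ m₂) with hX
  have hexpX : Real.exp (4 / (g : ℝ) * X) = mconst g m₁ m₂ := by
    rw [hX, ← mul_assoc, show 4 / (g : ℝ) * (g / 4) = 1 by field_simp, one_mul, Real.exp_log hm]
  have hcyl : ∀ r, r = X → ∀ t ≥ 0, Real.cos (A r t) = 0 := fun r hr t ht =>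
    (hfam r).1.cos_alpha_eq_zero (by rw [(hfam r).2.1, hr, hexpX])
      (by rw [(hfam r).2.2.2, Real.cos_pi_div_two]) ht
  set c : ℝ := xiStar m₁ m₂ Ξ Θ A with hc
  have hXc : X ≤ c := le_csInf hne fun r hr => by
    by_contra! hlt
    obtain ⟨T, hT, -, hT'⟩ := hr X hlt
    exact hT' (T / 2) ⟨by linarith, by linarith⟩ (by rw [hcyl X rfl _ (by linarith), zero_mul])
  have htype : ∀ r > c, Type1 m₁ m₂ Ξ Θ A r := fun r hr => by
    obtain ⟨q, hq, hqr⟩ := exists_lt_of_csInf_lt hne hr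
    exact hq r hqr
  rcases hXc.eq_or_lt with heq | hlt
  · exact ⟨1, one_pos, Or.inl (by rw [hcyl c heq.symm 1 zero_le_one, zero_mul])⟩
  by_contra! hcon
  have hE : ∀ r > X, mconst g m₁ m₂ < Real.exp (4 / (g : ℝ) * Ξ r 0) := fun r hr => by
    rw [(hfam r).2.1, ← hexpX]
    gcongr
  obtain ⟨hsol, -, hθ0, hα0⟩ := hfam c
  obtain ⟨hα, hθ⟩ := hsol.alpha_lt_pi_of_type_three hg0 hm₁ hm₂ (hE c hlt) hθ0 hα0
    (fun t ht => (hcon t ht).1) (fun t ht => (hcon t ht).2)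
  obtain ⟨δ, hδ, hnear⟩ := hsol.exists_near_axis hg0 hm₁ hm₂ hα hθ
  obtain ⟨ε, hε, hno⟩ := IsSolution.no_return_of_near_axis g hm₁ hm₂ (half_pos hδ)
  obtain ⟨a, ha, hEa, hθa⟩ := hnear (ε / 2) (half_pos hε)
  obtain ⟨s, hs, hmax⟩ := isCompact_Icc.exists_isMaxOn (Set.nonempty_Icc.2 ha.le)
    hsol.continuous_alpha.continuousOn
  have hαs : A c s < Real.pi := by
    rcases hs.1.eq_or_lt with heq | hs0
    · rw [← heq, hα0]
      linarith [Real.pi_pos]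
    · exact (hα s hs0).2
  have hcont : ContinuousAt (fun x => Real.exp (4 / (g : ℝ) * x) - mconst g m₁ m₂) (Ξ c a) := by
    fun_prop
  obtain ⟨ρ, hρ, hball⟩ := Metric.eventually_nhds_iff.1
    (hcont.eventually (gt_mem_nhds (show _ < -(δ / 2) by linarith)))
  obtain ⟨r, hr, hclose⟩ := hfam.exists_close c a (ε := min (ε / 2) (min (ρ / 2)
    ((Real.pi - A c s) / 2))) (lt_min (by linarith) (lt_min (by linarith) (by linarith)))
  have hζ1 := min_le_left (ε / 2) (min (ρ / 2) ((Real.pi - A c s) / 2))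
  have hζ2 := (min_le_right (ε / 2) (min (ρ / 2) ((Real.pi - A c s) / 2))).trans (min_le_left _ _)
  have hζ3 := (min_le_right (ε / 2) (min (ρ / 2) ((Real.pi - A c s) / 2))).trans (min_le_right _ _)
  obtain ⟨hr1, hr2, -⟩ := hclose a ⟨ha.le, le_rfl⟩
  obtain ⟨T, hT, hΘT, hneT⟩ := htype r hr
  obtain ⟨hsolr, -, hθr, hαr⟩ := hfam r
  refine hno _ _ _ hsolr hθr T hT hΘT
    (hsolr.alpha_mem_Ioo hm₁ hm₂ (hE r (hlt.trans hr)) hθr hαr hneT) a ha (fun t ht => ?_)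
    (hball (by rw [Real.dist_eq]; linarith)).le (by linarith [(abs_le.1 hr2).1])
  have h1 := (hclose t ⟨ht.1.le, ht.2⟩).2.2
  have h2 : A c t ≤ A c s := hmax ⟨ht.1.le, ht.2⟩
  linarith [(abs_le.1 h1).2]
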